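/- Suppose Q and W are symmetric positive definite, R + S is symmetric positive definite, and W_r is symmetric positive semidefinite (so that M, ρ, and (I − G_r)ᵀ Q (I − G_r) + W + W_r are invertible). For any u_k, y_d ∈ ℝ^n, the explicit update-law pair r⁺ = T_r u_k + L_r y_d and u⁺ = T_u u_k + L_u r⁺ satisfies the two first-order stationarity equations of the end-to-end ILC cost: [(I − G_r)ᵀ Q (I − G_r) + W + W_r] r⁺ = (I − G_r)ᵀ Q G u⁺ + W y_d, and M u⁺ = R u_k + Gᵀ Q (I − G_r) r⁺. -/

import Mathlib

open Matrix

/-- Under the stated positivity assumptions, for any `u_k, y_d` the explicit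
update-law pair `r⁺ = T_r u_k + L_r y_d`, `u⁺ = T_u u_k + L_u r⁺` satisfies the two
first-order stationarity equations of the end-to-end ILC cost:
`[(I - G_r)ᵀ Q (I - G_r) + W + W_r] r⁺ = (I - G_r)ᵀ Q G u⁺ + W y_d` and
`M u⁺ = R u_k + Gᵀ Q (I - G_r) r⁺`. -/
theorem stmt_8 (n : ℕ) (hn : 1 ≤ n)
    (G Gr Q R S W Wr M ρ Tu Lu Tr Lr : Matrix (Fin n) (Fin n) ℝ)
    (hQ : Q.PosDef) (hW : W.PosDef) (hRS : (R + S).PosDef) (hWr : Wr.PosSemidef)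
    (hM : M = Gᵀ * Q * G + R + S)
    (hρ : ρ = (1 - Gr)ᵀ * (Q⁻¹ + G * (R + S)⁻¹ * Gᵀ)⁻¹ * (1 - Gr) + W + Wr)
    (hTu : Tu = M⁻¹ * R) (hLu : Lu = M⁻¹ * Gᵀ * Q * (1 - Gr))
    (hTr : Tr = ρ⁻¹ * (1 - Gr)ᵀ * Q * G * Tu) (hLr : Lr = ρ⁻¹ * W)
    (u_k y_d rplus uplus : Fin n → ℝ)
    (hrplus : rplus = Tr.mulVec u_k + Lr.mulVec y_d)
    (huplus : uplus = Tu.mulVec u_k + Lu.mulVec rplus) :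
    ((1 - Gr)ᵀ * Q * (1 - Gr) + W + Wr).mulVec rplus =
        ((1 - Gr)ᵀ * Q * G).mulVec uplus + W.mulVec y_d ∧
      M.mulVec uplus = R.mulVec u_k + (Gᵀ * Q * (1 - Gr)).mulVec rplus := by
  have hN : (Gᵀ * Q * G).PosSemidef := by
    simpa using hQ.posSemidef.conjTranspose_mul_mul_same G
  have hMN : M = R + S + Gᵀ * Q * G := by rw [hM]; abel
  have hMu : IsUnit M := by
    rw [hMN]
    exact (hRS.add_posSemidef hN).isUnit
  have hX : (Q⁻¹ + G * (R + S)⁻¹ * Gᵀ).PosDef := by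
    refine hQ.inv.add_posSemidef ?_
    simpa using hRS.inv.posSemidef.mul_mul_conjTranspose_same G
  have hρu : IsUnit ρ := by
    have h : ((1 - Gr)ᵀ * (Q⁻¹ + G * (R + S)⁻¹ * Gᵀ)⁻¹ * (1 - Gr)).PosSemidef := by
      have h' := hX.inv.posSemidef.conjTranspose_mul_mul_same (1 - Gr)
      rwa [conjTranspose_eq_transpose_of_trivial] at h'
    rw [hρ]
    exact ((PosDef.posSemidef_add h hW).add_posSemidef hWr).isUnit
  have hQd := (isUnit_iff_isUnit_det _).1 hQ.isUnit
  have hRSd := (isUnit_iff_isUnit_det _).1 hRS.isUnit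
  have hMd := (isUnit_iff_isUnit_det _).1 hMu
  have hρd := (isUnit_iff_isUnit_det _).1 hρu
  have hwoodbury : (Q⁻¹ + G * (R + S)⁻¹ * Gᵀ)⁻¹ = Q - Q * G * M⁻¹ * Gᵀ * Q := by
    rw [add_mul_mul_inv_eq_sub _ _ _ _ hQ.inv.isUnit hRS.inv.isUnit]
    · rw [nonsing_inv_nonsing_inv _ hQd, nonsing_inv_nonsing_inv _ hRSd, ← hMN]
    · rwa [nonsing_inv_nonsing_inv _ hQd, nonsing_inv_nonsing_inv _ hRSd, ← hMN]
  have hsplit : (1 - Gr)ᵀ * Q * (1 - Gr) + W + Wr = ρ + (1 - Gr)ᵀ * Q * G * Lu := by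
    rw [hρ, hwoodbury, hLu]
    noncomm_ring
  have hρTr : ρ * Tr = (1 - Gr)ᵀ * Q * G * Tu := by
    simp only [hTr, Matrix.mul_assoc, mul_nonsing_inv_cancel_left _ _ hρd]
  have hρLr : ρ * Lr = W := by rw [hLr, mul_nonsing_inv_cancel_left _ _ hρd]
  have hMTu : M * Tu = R := by rw [hTu, mul_nonsing_inv_cancel_left _ _ hMd]
  have hMLu : M * Lu = Gᵀ * Q * (1 - Gr) := by
    simp only [hLu, Matrix.mul_assoc, mul_nonsing_inv_cancel_left _ _ hMd]
  have hρr : ρ *ᵥ rplus = ((1 - Gr)ᵀ * Q * G * Tu) *ᵥ u_k + W *ᵥ y_d := by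
    rw [hrplus, mulVec_add, mulVec_mulVec, mulVec_mulVec, hρTr, hρLr]
  constructor
  · rw [hsplit, add_mulVec, hρr, huplus, mulVec_add, mulVec_mulVec, mulVec_mulVec]
    abel
  · rw [huplus, mulVec_add, mulVec_mulVec, mulVec_mulVec, hMTu, hMLu]
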